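/- arXiv:2012.11166 — 6 statements merged into one kernel-verified Lean document; each statement's English description precedes it below -/
import Mathlib

section
/- Let ℓ and s be positive integers and let x_1,…,x_ℓ ∈ F_{q^m}. Let T(x_1,…,x_ℓ;s) be the s×ℓ matrix over F_{q^m} whose (i,j) entry is x_j^{q^i} for 1 ≤ i ≤ s, 1 ≤ j ≤ ℓ. If ρ = rank_q(x_1,…,x_ℓ), then the rank of T(x_1,…,x_ℓ;s) over the field F_{q^m} equals min(s, ρ). -/
open Finset

/-- The Moore matrix of elements linearly independent over a finite field is nonsingular. -/
theorem det_moore_ne_zero {F E : Type*} [Field F] [Fintype F] [Field E] [Algebra F E]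
    {k : ℕ} {y : Fin k → E} (hy : LinearIndependent F y) :
    (Matrix.of fun i j : Fin k => y j ^ Fintype.card F ^ (i : ℕ)).det ≠ 0 := by
  intro hdet
  obtain ⟨c, hc0, hc⟩ := Matrix.exists_vecMul_eq_zero_iff.mpr hdet
  set q := Fintype.card F with hq
  have hq1 : 1 < q := Fintype.one_lt_card
  have hroot (j : Fin k) : ∑ i, c i * y j ^ q ^ (i : ℕ) = 0 := congrFun hc j
  let P : Polynomial E := ∑ i : Fin k, Polynomial.C (c i) * Polynomial.X ^ q ^ (i : ℕ)
  let L : E →ₗ[F] E :=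
    ∑ i : Fin k, LinearMap.mulLeft F (c i) ∘ₗ
      (FiniteField.frobeniusAlgHom F E ^ (i : ℕ)).toLinearMap
  have hL (v : E) : L v = ∑ i : Fin k, c i * v ^ q ^ (i : ℕ) := by
    simp [L, AlgHom.coe_pow, FiniteField.coe_frobeniusAlgHom, pow_iterate, hq]
  have hPL (v : E) : P.eval v = L v := by
    simp [P, hL, Polynomial.eval_finsetSum]
  have hP : P = 0 := by
    refine Polynomial.eq_zero_of_natDegree_lt_card_of_eval_eq_zero P
      hy.fintypeLinearCombination_injective (fun a => ?_) ?_
    · simp [hPL, Fintype.linearCombination_apply, map_sum, hL (y _), hroot]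
    · rw [Fintype.card_fun, Fintype.card_fin, ← hq]
      refine (Polynomial.natDegree_sum_le_of_forall_le _ _ (n := q ^ k - 1) fun i _ => ?_).trans_lt
        (Nat.sub_lt (by positivity) one_pos)
      exact (Polynomial.natDegree_C_mul_X_pow_le _ _).trans
        (Nat.le_sub_one_of_lt (Nat.pow_lt_pow_right hq1 i.2))
  refine hc0 (funext fun i => ?_)
  have hcoeff := congrArg (fun p => Polynomial.coeff p (q ^ (i : ℕ))) hP
  simpa [P, Polynomial.finsetSum_coeff, Polynomial.coeff_X_pow, Nat.pow_right_inj hq1,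
    Fin.val_inj] using hcoeff

/-- Extending scalars along a linear map does not increase the dimension of a span. -/
theorem finrank_span_map_le {F E V U ι : Type*} [Field F] [Field E] [Algebra F E]
    [AddCommGroup V] [Module F V] [AddCommGroup U] [Module F U] [Module E U]
    [IsScalarTower F E U] [Finite ι] (φ : V →ₗ[F] U) (x : ι → V) :
    Module.finrank E (Submodule.span E (Set.range (φ ∘ x))) ≤
      Module.finrank F (Submodule.span F (Set.range x)) := by
  obtain ⟨κ, a, ha, hspan, hli⟩ := exists_linearIndependent' F x
  have := Finite.of_injective a ha
  have := Fintype.ofFinite κ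
  have hE : Submodule.span E (Set.range (φ ∘ x)) = Submodule.span E (Set.range (φ ∘ x ∘ a)) := by
    rw [← Submodule.span_span_of_tower F E (Set.range (φ ∘ x)),
      ← Submodule.span_span_of_tower F E (Set.range (φ ∘ x ∘ a)), Set.range_comp φ x,
      Set.range_comp φ (x ∘ a), Submodule.span_image, Submodule.span_image, hspan]
  rw [hE, ← hspan, finrank_span_eq_card hli]
  exact finrank_range_le_card _

/-- For `x₁, …, x_ℓ ∈ F_{q^m}` with `ρ = rank_q(x₁,…,x_ℓ)`, the rank over
`F_{q^m}` of the `s × ℓ` matrix `T` with entries `T_{i,j} = x_j^{q^i}` (for `1 ≤ i ≤ s`)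
equals `min(s, ρ)`. -/
theorem stmt_0 {F E : Type*} [Field F] [Fintype F] [Field E] [Fintype E] [Algebra F E]
    (q m : ℕ) (hq : Fintype.card F = q) (hm : Module.finrank F E = m)
    (l s : ℕ) (hl : 1 ≤ l) (hs : 1 ≤ s) (x : Fin l → E) (ρ : ℕ)
    (hρ : ρ = Module.finrank F (Submodule.span F (Set.range x))) :
    (Matrix.of fun (i : Fin s) (j : Fin l) => x j ^ q ^ ((i : ℕ) + 1)).rank = min s ρ := by
  subst hq
  set T := Matrix.of fun (i : Fin s) (j : Fin l) => x j ^ Fintype.card F ^ ((i : ℕ) + 1) with hT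
  refine le_antisymm (le_min T.rank_le_height ?_) ?_
  · let φ : E →ₗ[F] (Fin s → E) :=
      LinearMap.pi fun i => (FiniteField.frobeniusAlgHom F E ^ ((i : ℕ) + 1)).toLinearMap
    have hcol : T.col = φ ∘ x := by
      ext j i
      simp only [hT, φ, Matrix.col_apply, Matrix.of_apply, Function.comp_apply, LinearMap.pi_apply,
        AlgHom.toLinearMap_apply, AlgHom.coe_pow, FiniteField.coe_frobeniusAlgHom, pow_iterate]
    rw [Matrix.rank_eq_finrank_span_cols, hcol, hρ]
    exact finrank_span_map_le φ x
  · obtain ⟨κ, a, ha, hspan, hli⟩ := exists_linearIndependent' F x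
    have := Finite.of_injective a ha
    have := Fintype.ofFinite κ
    have hcard : Fintype.card κ = ρ := by rw [hρ, ← hspan, finrank_span_eq_card hli]
    let e : Fin (min s ρ) → κ :=
      (Fintype.equivFinOfCardEq hcard).symm ∘ Fin.castLE (min_le_right s ρ)
    have he : Function.Injective e :=
      (Equiv.injective _).comp (Fin.castLE_injective _)
    have hy := (hli.comp e he).map' (FiniteField.frobeniusAlgHom F E).toLinearMap
      (LinearMap.ker_eq_bot.mpr (FiniteField.frobeniusAlgHom F E).toRingHom.injective)
    have hsub : T.submatrix (Fin.castLE (min_le_left s ρ)) (a ∘ e) =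
        Matrix.of fun i j : Fin (min s ρ) => ((FiniteField.frobeniusAlgHom F E).toLinearMap ∘ (x ∘ a) ∘ e) j ^
            Fintype.card F ^ (i : ℕ) := by
      ext i j
      simp [hT, FiniteField.coe_frobeniusAlgHom, ← pow_mul, pow_succ']
    calc min s ρ = (T.submatrix (Fin.castLE (min_le_left s ρ)) (a ∘ e)).rank := by
          rw [hsub, Matrix.rank_of_isUnit _
            ((Matrix.isUnit_iff_isUnit_det _).mpr (det_moore_ne_zero hy).isUnit), Fintype.card_fin]
      _ ≤ T.rank := T.rank_submatrix_le _ _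
end

section
/- Let 1 ≤ r ≤ m. Then the number of vectors in (F_{q^m})^{m−r} whose m−r entries are F_q-linearly independent is strictly greater than q^{m(m−r)}·(q − 1 − q^{−r})/(q − 1) (an inequality of real numbers). -/
open Finset

/-- `Ω`: the set of vectors in `E^k` whose entries are `F`-linearly independent. -/
def OmegaSet (F E : Type*) [Field F] [Field E] [Algebra F E] (k : ℕ) : Set (Fin k → E) :=
  {x | LinearIndependent F x}

/-- A Weierstrass-type lower bound for `∏ i < k, (q ^ m - q ^ i)`, with denominators cleared. -/
theorem prod_pow_sub_pow_lower_bound {q : ℝ} (hq : 1 ≤ q) (m k : ℕ) (hk : k ≤ m) :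
    (q ^ m) ^ k * (q ^ m * (q - 1) - (q ^ k - 1)) ≤
      q ^ m * (q - 1) * ∏ i ∈ Finset.range k, (q ^ m - q ^ i) := by
  induction k with
  | zero => simp
  | succ k ih =>
    have h1 : 1 ≤ q ^ k := one_le_pow₀ hq
    have h2 : 0 ≤ q ^ m - q ^ k := sub_nonneg.2 (pow_le_pow_right₀ hq (by omega))
    have h3 : 0 ≤ (q ^ m) ^ k := by positivity
    have step := mul_le_mul_of_nonneg_right (ih (by omega)) h2
    have gap : 0 ≤ (q ^ m) ^ k * (q ^ k * (q ^ k - 1)) :=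
      mul_nonneg h3 (mul_nonneg (by linarith) (by linarith))
    rw [Finset.prod_range_succ, pow_succ (q ^ m) k, pow_succ q k]
    linear_combination step + gap

/-- For `1 ≤ r ≤ m`, the number of vectors in `(F_{q^m})^{m-r}` whose
entries are `F_q`-linearly independent is strictly greater than
`q^{m(m-r)} (q - 1 - q^{-r}) / (q - 1)`. -/
theorem stmt_1 {F E : Type*} [Field F] [Fintype F] [Field E] [Fintype E] [Algebra F E]
    (q m : ℕ) (hq : Fintype.card F = q) (hm : Module.finrank F E = m)
    (r : ℕ) (hr1 : 1 ≤ r) (hrm : r ≤ m) :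
    ((OmegaSet F E (m - r)).ncard : ℝ) >
      (q : ℝ) ^ (m * (m - r)) * ((q : ℝ) - 1 - ((q : ℝ) ^ r)⁻¹) / ((q : ℝ) - 1) := by
  have hq1 : (1 : ℝ) < q := by
    have : 1 < q := hq ▸ Fintype.one_lt_card
    exact_mod_cast this
  have hcard : ((OmegaSet F E (m - r)).ncard : ℝ) =
      ∏ i ∈ Finset.range (m - r), ((q : ℝ) ^ m - (q : ℝ) ^ i) := by
    have h := card_linearIndependent (K := F) (V := E) (k := m - r) (by omega)
    rw [hq, hm] at h
    change ((Nat.card {x : Fin (m - r) → E // LinearIndependent F x} : ℕ) : ℝ) = _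
    rw [h, Nat.cast_prod, ← Fin.prod_univ_eq_prod_range (fun i => (q : ℝ) ^ m - (q : ℝ) ^ i)]
    refine Finset.prod_congr rfl fun i _ => ?_
    have hi : q ^ (i : ℕ) ≤ q ^ m :=
      Nat.pow_le_pow_right (by exact_mod_cast hq1.le) (by omega)
    push_cast [Nat.cast_sub hi]
    rfl
  have hq0 : (0 : ℝ) < q := by linarith
  have hQ : (0 : ℝ) < (q : ℝ) ^ m := by positivity
  have bound := prod_pow_sub_pow_lower_bound hq1.le m (m - r) (by omega)
  have hsplit : (q : ℝ) ^ m * ((q : ℝ) ^ r)⁻¹ = (q : ℝ) ^ (m - r) := by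
    rw [← div_eq_mul_inv, div_eq_iff (by positivity), ← pow_add, Nat.sub_add_cancel hrm]
  have hpos : (0 : ℝ) < ((q : ℝ) ^ m) ^ (m - r) := by positivity
  rw [hcard, gt_iff_lt, div_lt_iff₀ (by linarith), pow_mul]
  refine lt_of_mul_lt_mul_left ?_ hQ.le
  linear_combination bound + hpos - ((q : ℝ) ^ m) ^ (m - r) * hsplit
end

section
/- Let s ≥ 1 and 1 ≤ r ≤ m−1, and let u = (u_1,…,u_{m−r}) ∈ (F_{q^m})^{m−r} be a nonzero vector with rank_q(u_1,…,u_{m−r}) ≤ s. Then there is no x = (x_1,…,x_{m−r}) ∈ Ω satisfying ∑_{j=1}^{m−r} u_j^{q^ℓ} x_j = 0 for all 1 ≤ ℓ ≤ s; that is, bad(u) = ∅. -/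
open Finset

/-- `bad(u)` for a fixed tuple `u`: the set of `x ∈ Ω` with `∑ⱼ uⱼ^{q^ℓ} xⱼ = 0`
for all `1 ≤ ℓ ≤ s`. -/
def badTuple (F : Type*) {E : Type*} [Field F] [Field E] [Algebra F E]
    (q s : ℕ) {k : ℕ} (u : Fin k → E) : Set (Fin k → E) :=
  {x | LinearIndependent F x ∧ ∀ ℓ : ℕ, 1 ≤ ℓ → ℓ ≤ s → ∑ j, u j ^ q ^ ℓ * x j = 0}

theorem frobeniusAlgHom_pow_apply {F E : Type*} [Field F] [Fintype F] [Field E] [Algebra F E]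
    (l : ℕ) (z : E) : (FiniteField.frobeniusAlgHom F E ^ l) z = z ^ Fintype.card F ^ l := by
  rw [AlgHom.coe_pow, FiniteField.coe_frobeniusAlgHom, pow_iterate]

/-- A nonzero `q`-polynomial of `q`-degree less than `t` cannot vanish at `t` elements that are
linearly independent over the field with `q` elements. -/
theorem eq_zero_of_sum_mul_pow_card_pow_eq_zero {F E : Type*} [Field F] [Fintype F] [Field E]
    [Algebra F E] {t : ℕ} {v : Fin t → E} (hv : LinearIndependent F v) {c : Fin t → E}
    (h : ∀ i, ∑ l, c l * v i ^ Fintype.card F ^ (l : ℕ) = 0) : c = 0 := by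
  have hq : 1 < Fintype.card F := Fintype.one_lt_card
  let φ : E →ₗ[F] E := ∑ l : Fin t, c l • (FiniteField.frobeniusAlgHom F E ^ (l : ℕ)).toLinearMap
  have hφ (z : E) : φ z = ∑ l, c l * z ^ Fintype.card F ^ (l : ℕ) := by
    simp only [φ, LinearMap.sum_apply, LinearMap.smul_apply, AlgHom.toLinearMap_apply,
      frobeniusAlgHom_pow_apply, smul_eq_mul]
  let P : Polynomial E := ∑ l : Fin t, Polynomial.monomial (Fintype.card F ^ (l : ℕ)) (c l)
  have hcoeff (l : Fin t) : P.coeff (Fintype.card F ^ (l : ℕ)) = c l := by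
    simp [P, Polynomial.finsetSum_coeff, Polynomial.coeff_monomial,
      Nat.pow_right_inj hq, Fin.val_inj]
  have hP : P = 0 := by
    refine Polynomial.eq_zero_of_natDegree_lt_card_of_eval_eq_zero P
      (f := fun a : Fin t → F => ∑ i, a i • v i) ?_ ?_ ?_
    · exact linearIndependent_iff_injective_fintypeLinearCombination.mp hv
    · intro a
      have : φ (∑ i, a i • v i) = 0 := by
        rw [map_sum]
        exact Finset.sum_eq_zero fun i _ => by rw [map_smul, hφ, h, smul_zero]
      rw [← this, hφ]
      simp [P, Polynomial.eval_finsetSum]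
    · rw [Fintype.card_fun, Fintype.card_fin]
      refine Nat.lt_of_le_pred (by positivity) ?_
      refine Polynomial.natDegree_sum_le_of_forall_le _ _ fun l _ =>
        (Polynomial.natDegree_monomial_le _).trans (Nat.le_pred_of_lt ?_)
      exact Nat.pow_lt_pow_right hq l.isLt
  ext l
  rw [← hcoeff l, hP]; simp

/-- The Moore matrix with rows `v ^ q, …, v ^ q ^ t` of a linearly independent tuple `v` has
trivial kernel. -/
theorem eq_zero_of_sum_pow_card_pow_mul_eq_zero {F E : Type*} [Field F] [Fintype F] [Field E]
    [Algebra F E] {t : ℕ} {v : Fin t → E} (hv : LinearIndependent F v) {y : Fin t → E}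
    (h : ∀ l : ℕ, 1 ≤ l → l ≤ t → ∑ i, v i ^ Fintype.card F ^ l * y i = 0) : y = 0 := by
  have hw : LinearIndependent F fun i => v i ^ Fintype.card F :=
    hv.map' (FiniteField.frobeniusAlgHom F E).toLinearMap
      (LinearMap.ker_eq_bot.mpr (FiniteField.frobeniusAlgHom F E).toRingHom.injective)
  by_contra hy
  let M : Matrix (Fin t) (Fin t) E := fun l i => (v i ^ Fintype.card F) ^ Fintype.card F ^ (l : ℕ)
  have hM : M.det = 0 := by
    refine Matrix.exists_mulVec_eq_zero_iff.mp ⟨y, hy, ?_⟩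
    ext l
    simpa [M, Matrix.mulVec, dotProduct, ← pow_mul, ← pow_succ'] using
      h (l + 1) (by omega) (by omega)
  obtain ⟨c, hc, hcM⟩ := Matrix.exists_vecMul_eq_zero_iff.mpr hM
  exact hc (eq_zero_of_sum_mul_pow_card_pow_eq_zero hw fun i => congrFun hcM i)

/-- If `u ∈ (F_{q^m})^{m-r}` is nonzero with `rank_q(u) ≤ s`, then there is no
`x` with `F_q`-linearly independent entries satisfying `∑ⱼ uⱼ^{q^ℓ} xⱼ = 0` for all
`1 ≤ ℓ ≤ s`; that is, `bad(u) = ∅`. -/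
theorem stmt_2 {F E : Type*} [Field F] [Fintype F] [Field E] [Fintype E] [Algebra F E]
    (q m s r : ℕ) (hq : Fintype.card F = q) (hm : Module.finrank F E = m)
    (hs : 1 ≤ s) (hr1 : 1 ≤ r) (hrm : r ≤ m - 1)
    (u : Fin (m - r) → E) (hu : u ≠ 0)
    (hrank : Module.finrank F (Submodule.span F (Set.range u)) ≤ s) :
    badTuple F q s u = ∅ := by
  subst hq
  rw [Set.eq_empty_iff_forall_notMem]
  rintro x ⟨hx, hsum⟩
  let b := Module.finBasis F (Submodule.span F (Set.range u))
  let a j := b.repr ⟨u j, Submodule.subset_span ⟨j, rfl⟩⟩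
  have hb : LinearIndependent F fun i => (b i : E) :=
    b.linearIndependent.map' (Submodule.subtype _) (Submodule.ker_subtype _)
  have hua (j) : u j = ∑ i, a j i • (b i : E) := by
    have := congrArg Subtype.val (b.sum_repr ⟨u j, Submodule.subset_span ⟨j, rfl⟩⟩)
    rw [Submodule.coe_sum] at this
    exact this.symm
  have hpow (j) (l : ℕ) : u j ^ Fintype.card F ^ l =
      ∑ i, a j i • (b i : E) ^ Fintype.card F ^ l := by
    have := congrArg (FiniteField.frobeniusAlgHom F E ^ l) (hua j)
    simpa only [map_sum, map_smul, frobeniusAlgHom_pow_apply] using this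
  have hy := eq_zero_of_sum_pow_card_pow_mul_eq_zero hb (y := fun i => ∑ j, a j i • x j) <| by
    intro l hl hlt
    rw [← hsum l hl (hlt.trans hrank)]
    simp only [hpow, Finset.mul_sum, Finset.sum_mul, mul_smul_comm, smul_mul_assoc]
    exact Finset.sum_comm
  apply hu
  ext j
  rw [hua j]
  refine Finset.sum_eq_zero fun i _ => ?_
  rw [Fintype.linearIndependent_iff.mp hx (fun j => a j i) (congrFun hy i) j, zero_smul]
end

section
/- Let s ≥ 1 and 1 ≤ r ≤ m−1, and let u = (u_1,…,u_{m−r}) ∈ (F_{q^m})^{m−r} with rank_q(u_1,…,u_{m−r}) ≥ s+1. Then |bad(u)| < q^{m(m−r−s)}. -/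
open Finset

/-- A `q`-polynomial `∑ᵢ cᵢ X^{q^{i+1}}` with `s` terms that vanishes on a family spanning an
`F`-space of dimension at least `s + 1` has all coefficients zero. -/
lemma linearIndependent_pow_card_pow {F E : Type*} [Field F] [Fintype F] [Field E] [Fintype E]
    [Algebra F E] {s k : ℕ} (u : Fin k → E)
    (hrank : s + 1 ≤ Module.finrank F (Submodule.span F (Set.range u))) :
    LinearIndependent E (fun (i : Fin s) (j : Fin k) => u j ^ Fintype.card F ^ (i.val + 1)) := by
  classical
  have hq : 1 < Fintype.card F := Fintype.one_lt_card
  rw [Fintype.linearIndependent_iff]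
  intro c hc
  let L : E →ₗ[F] E :=
    ∑ i : Fin s, LinearMap.mulLeft F (c i) ∘ₗ
      ((FiniteField.frobeniusAlgHom F E ^ (i.val + 1) : E →ₐ[F] E) : E →ₗ[F] E)
  have hL (x : E) : L x = ∑ i : Fin s, c i * x ^ Fintype.card F ^ (i.val + 1) := by
    simp [L, AlgHom.coe_pow, FiniteField.coe_frobeniusAlgHom, pow_iterate, ← pow_mul, pow_succ,
      mul_comm (Fintype.card F)]
  have hker : Submodule.span F (Set.range u) ≤ LinearMap.ker L := by
    rw [Submodule.span_le]
    rintro _ ⟨j, rfl⟩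
    have := congrFun hc j
    simpa [hL] using this
  let P : Polynomial E :=
    ∑ i : Fin s, Polynomial.C (c i) * Polynomial.X ^ Fintype.card F ^ (i.val + 1)
  have hdeg : P.natDegree ≤ Fintype.card F ^ s := by
    refine Polynomial.natDegree_sum_le_of_forall_le _ _ fun i _ => ?_
    exact (Polynomial.natDegree_C_mul_X_pow_le _ _).trans
      (Nat.pow_le_pow_right hq.le i.isLt)
  have hcard : Fintype.card F ^ (s + 1) ≤ Fintype.card (Submodule.span F (Set.range u)) := by
    rw [Module.card_eq_pow_finrank (K := F) (V := Submodule.span F (Set.range u))]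
    exact Nat.pow_le_pow_right hq.le hrank
  have hP : P = 0 := by
    refine Polynomial.eq_zero_of_natDegree_lt_card_of_eval_eq_zero P
      (f := ((↑) : Submodule.span F (Set.range u) → E)) Subtype.val_injective ?_ ?_
    · intro x
      have : L x = 0 := hker x.2
      rw [hL] at this
      simpa [P, Polynomial.eval_finsetSum] using this
    · exact (hdeg.trans_lt (Nat.pow_lt_pow_right hq s.lt_succ_self)).trans_le hcard
  intro i
  have hcoeff := congrArg (fun p => p.coeff (Fintype.card F ^ (i.val + 1))) hP
  simpa [P, Polynomial.finsetSum_coeff, Polynomial.coeff_C_mul_X_pow,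
    Nat.pow_right_inj hq, Fin.val_inj] using hcoeff

/-- If `u ∈ (F_{q^m})^{m-r}` has `rank_q(u) ≥ s + 1`, then
`|bad(u)| < q^{m(m-r-s)}`. -/
theorem stmt_3 {F E : Type*} [Field F] [Fintype F] [Field E] [Fintype E] [Algebra F E]
    (q m s r : ℕ) (hq : Fintype.card F = q) (hm : Module.finrank F E = m)
    (hs : 1 ≤ s) (hr1 : 1 ≤ r) (hrm : r ≤ m - 1)
    (u : Fin (m - r) → E)
    (hrank : s + 1 ≤ Module.finrank F (Submodule.span F (Set.range u))) :
    (badTuple F q s u).ncard < q ^ (m * (m - r - s)) := by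
  classical
  let A : Matrix (Fin s) (Fin (m - r)) E := fun i j => u j ^ Fintype.card F ^ (i.val + 1)
  have hA : A.rank = s := by
    have : LinearIndependent E A.row := linearIndependent_pow_card_pow u hrank
    simpa using this.rank_matrix
  have hdim : Module.finrank E (LinearMap.ker A.mulVecLin) = m - r - s := by
    have h := A.mulVecLin.finrank_range_add_finrank_ker
    rw [← Matrix.rank, hA, Module.finrank_fin_fun] at h
    omega
  have hcard : (LinearMap.ker A.mulVecLin : Set (Fin (m - r) → E)).ncard
      = q ^ (m * (m - r - s)) := by
    rw [← Nat.card_coe_set_eq, SetLike.coe_sort_coe, Nat.card_eq_fintype_card,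
      Module.card_eq_pow_finrank (K := E), hdim, Module.card_eq_pow_finrank (K := F) (V := E),
      hm, hq, pow_mul]
  rw [← hcard]
  refine Set.ncard_lt_ncard ((Set.ssubset_iff_of_subset ?_).2 ⟨0, zero_mem _, ?_⟩)
    (Set.toFinite _)
  · rintro x ⟨-, hx⟩
    ext i
    have h := hx (i.val + 1) (by omega) i.isLt
    rw [← hq] at h
    exact h
  · rintro ⟨h, -⟩
    exact h.ne_zero (⟨0, by omega⟩ : Fin (m - r)) rfl
end

section
/- Let s ≥ 1, 1 ≤ r ≤ m−1, let a be a common divisor of m and d with d ≥ 1, and let U ⊆ F_{q^m} be an F_{q^a}-linear subspace of F_{q^a}-dimension d/a. Then the proportion |Ω ∖ bad(U)| / |Ω| is at least 1 − (q^{d(m−r)−ms}/(q^a − 1)) · ((q − 1)/(q − 1 − q^{−r})) (an inequality of real numbers). Equivalently, if a vector v′ is drawn uniformly at random from Ω and V is the F_q-subspace of dimension r with V^⊥ equal to the F_q-span of the entries of v′, then the probability that (U,V) is a good pair is at least this quantity. -/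
open Finset

/-- `bad(U)`: the set of `x ∈ Ω` for which there is a not-all-zero tuple `u` with entries in `U`
such that `∑ⱼ uⱼ^{q^ℓ} xⱼ = 0` for all `1 ≤ ℓ ≤ s`. -/
def badSet (F : Type*) {E : Type*} [Field F] [Field E] [Algebra F E]
    (q s k : ℕ) (U : Set E) : Set (Fin k → E) :=
  {x | LinearIndependent F x ∧ ∃ u : Fin k → E, (∀ j, u j ∈ U) ∧ u ≠ 0 ∧
      ∀ ℓ : ℕ, 1 ≤ ℓ → ℓ ≤ s → ∑ j, u j ^ q ^ ℓ * x j = 0}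

section Moore

variable {F E : Type*} [Field F] [Fintype F] [Field E] [Algebra F E]

/-- The `q`-linearized polynomial map `x ↦ ∑ i < n, c i * x ^ q ^ (i + 1)`, where `q = |F|`. -/
noncomputable def linearizedMap (F : Type*) {E : Type*} [Field F] [Fintype F] [Field E]
    [Algebra F E] {n : ℕ} (c : Fin n → E) : E →ₗ[F] E :=
  ∑ i : Fin n, c i • (FiniteField.frobeniusAlgHom F E ^ ((i : ℕ) + 1)).toLinearMap

lemma frobeniusAlgHom_pow_apply_s5 (n : ℕ) (x : E) :
    (FiniteField.frobeniusAlgHom F E ^ n) x = x ^ Fintype.card F ^ n := by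
  rw [AlgHom.coe_pow, FiniteField.coe_frobeniusAlgHom, pow_iterate]

lemma linearizedMap_apply {n : ℕ} (c : Fin n → E) (x : E) :
    linearizedMap F c x = ∑ i : Fin n, c i * x ^ Fintype.card F ^ ((i : ℕ) + 1) := by
  simp only [linearizedMap, LinearMap.sum_apply, LinearMap.smul_apply, AlgHom.toLinearMap_apply,
    frobeniusAlgHom_pow_apply_s5, smul_eq_mul]

/-- A nonzero linearized map with `n` coefficients has a kernel of dimension less than `n`. -/
lemma eq_zero_of_linearizedMap_eq_zero_on [Fintype E] {n : ℕ} {c : Fin n → E} (V : Submodule F E)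
    (hn : n ≤ Module.finrank F V) (hV : ∀ v ∈ V, linearizedMap F c v = 0) : c = 0 := by
  classical
  set q := Fintype.card F with hq
  have hq1 : 1 < q := Fintype.one_lt_card
  let p : Polynomial E := ∑ i : Fin n, Polynomial.monomial (q ^ (i : ℕ)) (c i)
  have hp : p = 0 := by
    refine Polynomial.eq_zero_of_natDegree_lt_card_of_eval_eq_zero p
      (f := fun v : V => FiniteField.frobeniusAlgHom F E v)
      ((RingHom.injective (FiniteField.frobeniusAlgHom F E).toRingHom).comp
        Subtype.val_injective) (fun v => ?_) ?_
    · have h := hV v v.2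
      rw [linearizedMap_apply] at h
      rw [← h, Polynomial.eval_finsetSum]
      refine Finset.sum_congr rfl fun i _ => ?_
      simp [← pow_mul, pow_succ', ← hq]
    · rw [Module.card_eq_pow_finrank (K := F) (V := V), ← hq]
      refine lt_of_lt_of_le ?_ (Nat.pow_le_pow_right hq1.le hn)
      refine (Nat.lt_iff_le_pred (by positivity)).2 ?_
      refine Polynomial.natDegree_sum_le_of_forall_le _ _ fun i _ => ?_
      refine (Polynomial.natDegree_monomial_le _).trans (Nat.le_pred_of_lt ?_)
      exact Nat.pow_lt_pow_right hq1 i.2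
  funext i
  have h : p.coeff (q ^ (i : ℕ)) = 0 := by rw [hp, Polynomial.coeff_zero]
  simpa [p, Polynomial.finsetSum_coeff, Polynomial.coeff_monomial,
    (Nat.pow_right_injective hq1).eq_iff, Fin.val_inj] using h

/-- The rectangular Moore matrix with entries `u j ^ q ^ (i + 1)`. -/
def mooreMatrix (F : Type*) {E : Type*} [Fintype F] [Field E] (n : ℕ) {k : ℕ}
    (u : Fin k → E) : Matrix (Fin n) (Fin k) E :=
  Matrix.of fun i j => u j ^ Fintype.card F ^ ((i : ℕ) + 1)

lemma vecMul_mooreMatrix {n k : ℕ} (c : Fin n → E) (u : Fin k → E) (j : Fin k) :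
    Matrix.vecMul c (mooreMatrix F n u) j = linearizedMap F c (u j) := by
  rw [linearizedMap_apply]; rfl

/-- The rows of a Moore matrix are independent when its parameters span enough dimensions. -/
lemma eq_zero_of_vecMul_mooreMatrix_eq_zero [Fintype E] {n k : ℕ} {c : Fin n → E} {u : Fin k → E}
    (hn : n ≤ Module.finrank F (Submodule.span F (Set.range u)))
    (hc : Matrix.vecMul c (mooreMatrix F n u) = 0) : c = 0 := by
  refine eq_zero_of_linearizedMap_eq_zero_on _ hn fun v hv => ?_
  have hle : Submodule.span F (Set.range u) ≤ LinearMap.ker (linearizedMap F c) := by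
    rw [Submodule.span_le]
    rintro _ ⟨j, rfl⟩
    simpa [vecMul_mooreMatrix] using congrFun hc j
  exact hle hv

/-- The columns of a Moore matrix with enough rows satisfy no relation with
`F`-independent coefficients. -/
lemma eq_zero_of_mooreMatrix_mulVec_eq_zero [Fintype E] {n k : ℕ} {u x : Fin k → E}
    (hn : Module.finrank F (Submodule.span F (Set.range u)) ≤ n)
    (hx : LinearIndependent F x) (hux : Matrix.mulVec (mooreMatrix F n u) x = 0) : u = 0 := by
  classical
  set V := Submodule.span F (Set.range u)
  set t := Module.finrank F V
  let b : Module.Basis (Fin t) F V := Module.finBasis F V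
  let w : Fin t → E := fun i => b i
  let A : Fin k → Fin t → F := fun j i => b.repr ⟨u j, Submodule.subset_span ⟨j, rfl⟩⟩ i
  have hA : ∀ j, u j = ∑ i, A j i • w i := fun j => by
    have h := congrArg V.subtype (b.sum_repr ⟨u j, Submodule.subset_span ⟨j, rfl⟩⟩)
    rw [map_sum] at h
    exact h.symm
  let y : Fin t → E := fun i => ∑ j, A j i • x j
  have hspan : Submodule.span F (Set.range w) = V := by
    have h := congrArg (Submodule.map V.subtype) b.span_eq
    rw [Submodule.map_span, Submodule.map_subtype_top, ← Set.range_comp] at h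
    exact h
  have hdet : (mooreMatrix F t w).det ≠ 0 := by
    intro h
    obtain ⟨c, hc0, hc⟩ := Matrix.exists_vecMul_eq_zero_iff.2 h
    exact hc0 (eq_zero_of_vecMul_mooreMatrix_eq_zero (by rw [hspan]) hc)
  have hy : y = 0 := by
    refine Matrix.eq_zero_of_mulVec_eq_zero hdet (funext fun l => ?_)
    have h := congrFun hux ⟨l, l.2.trans_le hn⟩
    simp only [Matrix.mulVec, dotProduct, mooreMatrix, Matrix.of_apply, Pi.zero_apply] at h ⊢
    rw [← h]
    simp only [← frobeniusAlgHom_pow_apply_s5, hA, map_sum, map_smul, y, Finset.mul_sum, Finset.sum_mul]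
    rw [Finset.sum_comm]
    simp only [mul_smul_comm, smul_mul_assoc]
  funext j
  rw [hA]
  refine Finset.sum_eq_zero fun i _ => ?_
  rw [Fintype.linearIndependent_iff.1 hx (fun j => A j i) (congrFun hy i) j, zero_smul]

/-- For a nonzero `u`, at most `|E| ^ (k - n)` vectors with `F`-independent entries lie in the
kernel of the Moore matrix of `u`. -/
lemma ncard_linearIndependent_mooreMatrix_ker_mul_le [Fintype E] {n k : ℕ} {u : Fin k → E}
    (hu : u ≠ 0) :
    {x : Fin k → E | LinearIndependent F x ∧ Matrix.mulVec (mooreMatrix F n u) x = 0}.ncard *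
      Fintype.card E ^ n ≤ Fintype.card E ^ k := by
  classical
  rcases le_total (Module.finrank F (Submodule.span F (Set.range u))) n with hn | hn
  · have : {x : Fin k → E | LinearIndependent F x ∧
        Matrix.mulVec (mooreMatrix F n u) x = 0} = ∅ := by
      ext x
      simp only [Set.mem_ofPred_eq, Set.mem_empty_iff_false, iff_false]
      rintro ⟨hx, h⟩
      exact hu (eq_zero_of_mooreMatrix_mulVec_eq_zero hn hx h)
    simp [this]
  · have hrow : LinearIndependent E (mooreMatrix F n u).row := by
      rw [← Matrix.vecMul_injective_iff]
      refine (injective_iff_map_eq_zero (Matrix.vecMulLinear (mooreMatrix F n u))).2 fun c hc => ?_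
      exact eq_zero_of_vecMul_mooreMatrix_eq_zero hn hc
    have hrank := hrow.rank_matrix
    have hadd := LinearMap.finrank_range_add_finrank_ker (mooreMatrix F n u).mulVecLin
    rw [Matrix.rank] at hrank
    rw [hrank] at hadd
    simp only [Fintype.card_fin, Module.finrank_fintype_fun_eq_card] at hadd
    have hle : {x : Fin k → E | LinearIndependent F x ∧
        Matrix.mulVec (mooreMatrix F n u) x = 0}.ncard ≤
        Fintype.card E ^ Module.finrank E (LinearMap.ker (mooreMatrix F n u).mulVecLin) := by
      rw [← Module.card_eq_pow_finrank (K := E)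
        (V := LinearMap.ker (mooreMatrix F n u).mulVecLin), ← Nat.card_eq_fintype_card]
      change _ ≤ Set.ncard (LinearMap.ker (mooreMatrix F n u).mulVecLin : Set (Fin k → E))
      exact Set.ncard_le_ncard (fun x hx => hx.2) (Set.toFinite _)
    calc _ ≤ _ := Nat.mul_le_mul_right _ hle
      _ = _ := by rw [← pow_add, add_comm, hadd]

end Moore

/-- Double counting over the pairs `(x, u)` witnessing that `x` is bad. -/
lemma ncard_badSet_mul_le {F Fa E : Type*} [Field F] [Fintype F] [Field Fa] [Fintype Fa]
    [Field E] [Fintype E] [Algebra Fa E] [Algebra F E] (s k : ℕ) (U : Submodule Fa E) :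
    (badSet F (Fintype.card F) s k (U : Set E)).ncard * (Fintype.card Fa - 1) *
      Fintype.card E ^ s ≤ Nat.card U ^ k * Fintype.card E ^ k := by
  classical
  let R : (Fin k → E) → (Fin k → E) → Prop := fun x u =>
    LinearIndependent F x ∧ Matrix.mulVec (mooreMatrix F s u) x = 0
  let B : Finset (Fin k → E) := (badSet F (Fintype.card F) s k (U : Set E)).toFinset
  let T : Finset (Fin k → E) := Finset.univ.filter fun u => (∀ j, u j ∈ U) ∧ u ≠ 0
  have hB : (badSet F (Fintype.card F) s k (U : Set E)).ncard = B.card :=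
    Set.ncard_eq_toFinset_card' _
  have hT : T.card ≤ Nat.card U ^ k := by
    have h1 : T ⊆ Fintype.piFinset fun _ => Finset.univ.filter (· ∈ U) := fun u hu => by
      simpa [T] using (Finset.mem_filter.1 hu).2.1
    refine (Finset.card_le_card h1).trans_eq ?_
    rw [Fintype.card_piFinset_const, Nat.card_eq_fintype_card, Fintype.card_subtype]
  have hlow : ∀ x ∈ B, Fintype.card Fa - 1 ≤ (T.bipartiteAbove R x).card := by
    intro x hx
    obtain ⟨hxi, u, huU, hu0, hux⟩ := Set.mem_toFinset.1 hx
    rw [← Fintype.card_units]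
    refine Finset.card_le_card_of_injOn (s := Finset.univ) (fun c : Faˣ => (c : Fa) • u) ?_ ?_
    · intro c _
      simp only [Finset.mem_coe, Finset.mem_bipartiteAbove, T, Finset.mem_filter,
        Finset.mem_univ, true_and]
      refine ⟨⟨fun j => U.smul_mem _ (huU j), smul_ne_zero c.ne_zero hu0⟩, hxi, funext fun l => ?_⟩
      have h := hux (l + 1) (by omega) (by omega)
      simp only [Matrix.mulVec, dotProduct, mooreMatrix, Matrix.of_apply, Pi.zero_apply,
        Pi.smul_apply, smul_pow, smul_mul_assoc, ← Finset.smul_sum, h, smul_zero]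
    · intro c _ c' _ h
      exact Units.ext (smul_left_injective Fa hu0 h)
  have hup : ∀ u ∈ T, (B.bipartiteBelow R u).card * Fintype.card E ^ s ≤ Fintype.card E ^ k := by
    intro u hu
    refine le_trans (Nat.mul_le_mul_right _ ?_)
      (ncard_linearIndependent_mooreMatrix_ker_mul_le (F := F) (Finset.mem_filter.1 hu).2.2)
    rw [← Set.ncard_coe_finset]
    exact Set.ncard_le_ncard (fun x hx => ((Finset.mem_bipartiteBelow R).1 hx).2) (Set.toFinite _)
  calc _ = (∑ x ∈ B, (Fintype.card Fa - 1)) * Fintype.card E ^ s := by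
        rw [hB, Finset.sum_const, smul_eq_mul]
    _ ≤ (∑ x ∈ B, (T.bipartiteAbove R x).card) * Fintype.card E ^ s :=
        Nat.mul_le_mul_right _ (Finset.sum_le_sum hlow)
    _ = ∑ u ∈ T, (B.bipartiteBelow R u).card * Fintype.card E ^ s := by
        rw [Finset.sum_card_bipartiteAbove_eq_sum_card_bipartiteBelow, Finset.sum_mul]
    _ ≤ ∑ u ∈ T, Fintype.card E ^ k := Finset.sum_le_sum hup
    _ = T.card * Fintype.card E ^ k := by rw [Finset.sum_const, smul_eq_mul]
    _ ≤ _ := Nat.mul_le_mul_right _ hT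

/-- A Weierstrass product inequality for `∏ (N - f i)`. -/
lemma pow_mul_sub_sum_le_mul_prod_sub {N : ℝ} {f : ℕ → ℝ} {k : ℕ} (hN : 0 ≤ N)
    (hf : ∀ i < k, 0 ≤ f i ∧ f i ≤ N) :
    N ^ k * (N - ∑ i ∈ Finset.range k, f i) ≤ N * ∏ i ∈ Finset.range k, (N - f i) := by
  induction k with
  | zero => simp
  | succ k ih =>
    have h := mul_le_mul_of_nonneg_right (ih fun i hi => hf i (by omega))
      (sub_nonneg.2 (hf k (by omega)).2)
    have hS : 0 ≤ ∑ i ∈ Finset.range k, f i :=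
      Finset.sum_nonneg fun i hi => (hf i (by have := Finset.mem_range.1 hi; omega)).1
    have h2 := mul_nonneg (pow_nonneg hN k) (mul_nonneg hS (hf k (by omega)).1)
    rw [Finset.prod_range_succ, Finset.sum_range_succ, pow_succ]
    nlinarith

lemma pow_mul_le_ncard_OmegaSet_mul {F E : Type*} [Field F] [Fintype F] [Field E] [Fintype E]
    [Algebra F E] {k r : ℕ} (hm : Module.finrank F E = k + r) :
    ((Fintype.card F : ℝ) ^ (k + r)) ^ k *
        ((Fintype.card F : ℝ) - 1 - ((Fintype.card F : ℝ) ^ r)⁻¹) ≤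
      ((OmegaSet F E k).ncard : ℝ) * ((Fintype.card F : ℝ) - 1) := by
  have hcard : (OmegaSet F E k).ncard =
      ∏ i : Fin k, (Fintype.card F ^ (k + r) - Fintype.card F ^ (i : ℕ)) := by
    rw [← hm]
    exact card_linearIndependent (K := F) (V := E) (by omega)
  have hq1 : 1 < Fintype.card F := Fintype.one_lt_card
  generalize Fintype.card F = q at *
  have hq1' : (1 : ℝ) < q := by exact_mod_cast hq1
  have hprod : ((OmegaSet F E k).ncard : ℝ) =
      ∏ i ∈ Finset.range k, ((q : ℝ) ^ (k + r) - (q : ℝ) ^ i) := by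
    rw [hcard, Finset.prod_range, Nat.cast_prod]
    refine Finset.prod_congr rfl fun i _ => ?_
    rw [Nat.cast_sub (Nat.pow_le_pow_right hq1.le (by omega))]
    push_cast
    rfl
  have hN : (0 : ℝ) < (q : ℝ) ^ (k + r) := by positivity
  have hW := pow_mul_sub_sum_le_mul_prod_sub (N := (q : ℝ) ^ (k + r)) (f := fun i => (q : ℝ) ^ i)
    (k := k) hN.le fun i hi =>
      ⟨by positivity, pow_le_pow_right₀ hq1'.le (by omega)⟩
  rw [← hprod] at hW
  have hgeom := geom_sum_mul (q : ℝ) k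
  have hr : (q : ℝ) ^ (k + r) * ((q : ℝ) ^ r)⁻¹ = (q : ℝ) ^ k := by
    rw [pow_add]; field_simp
  have h := mul_le_mul_of_nonneg_right hW (sub_nonneg.2 hq1'.le)
  have hk := pow_pos hN k
  refine le_of_mul_le_mul_left ?_ hN
  calc _ = ((q : ℝ) ^ (k + r)) ^ k * ((q : ℝ) ^ (k + r) * (q - 1) - (q : ℝ) ^ k) := by
        rw [← hr]; ring
    _ ≤ ((q : ℝ) ^ (k + r)) ^ k * ((q : ℝ) ^ (k + r) * (q - 1) - ((q : ℝ) ^ k - 1)) := by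
        gcongr; linarith
    _ = _ := by rw [← hgeom]; ring
    _ ≤ _ := h.trans_eq (by ring)

/-- If `a` is a common divisor of `m` and `d`, `d ≥ 1`, and `U ⊆ F_{q^m}` is an
`F_{q^a}`-subspace of `F_{q^a}`-dimension `d/a`, then the proportion `|Ω \ bad(U)| / |Ω|` is at
least `1 - (q^{d(m-r) - ms}/(q^a - 1)) · ((q - 1)/(q - 1 - q^{-r}))` (as real numbers). -/
theorem stmt_5 {F Fa E : Type*} [Field F] [Fintype F] [Field Fa] [Fintype Fa]
    [Field E] [Fintype E] [Algebra F Fa] [Algebra Fa E] [Algebra F E] [IsScalarTower F Fa E]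
    (q m s r a d : ℕ) (hq : Fintype.card F = q) (hm : Module.finrank F E = m)
    (hqa : Fintype.card Fa = q ^ a)
    (hs : 1 ≤ s) (hr1 : 1 ≤ r) (hrm : r ≤ m - 1) (hd : 1 ≤ d) (ham : a ∣ m) (had : a ∣ d)
    (U : Submodule Fa E) (hUa : Module.finrank Fa U = d / a) (hUd : Module.finrank F U = d) :
    ((OmegaSet F E (m - r) \ badSet F q s (m - r) (U : Set E)).ncard : ℝ) /
        ((OmegaSet F E (m - r)).ncard : ℝ) ≥
      1 - (q : ℝ) ^ (((d * (m - r) : ℕ) : ℤ) - ((m * s : ℕ) : ℤ)) / ((q : ℝ) ^ a - 1) *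
        (((q : ℝ) - 1) / ((q : ℝ) - 1 - ((q : ℝ) ^ r)⁻¹)) := by
  subst hq
  have hq1 : (1 : ℝ) < Fintype.card F := by exact_mod_cast Fintype.one_lt_card
  have hqa1 : (1 : ℝ) < (Fintype.card F : ℝ) ^ a := by
    rw [← Nat.cast_pow, ← hqa]; exact_mod_cast Fintype.one_lt_card
  obtain ⟨k, rfl⟩ : ∃ k, m = k + r := ⟨m - r, by omega⟩
  rw [Nat.add_sub_cancel]
  have hE : Fintype.card E = Fintype.card F ^ (k + r) := by
    rw [← hm]; exact Module.card_eq_pow_finrank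
  have hU : Nat.card U = Fintype.card F ^ d := by
    classical
    rw [← hUd, Nat.card_eq_fintype_card]; exact Module.card_eq_pow_finrank
  have hbad := ncard_badSet_mul_le (F := F) s k U
  rw [hU, hE, hqa] at hbad
  have hbad' : ((badSet F (Fintype.card F) s k (U : Set E)).ncard : ℝ) *
      ((Fintype.card F : ℝ) ^ a - 1) * ((Fintype.card F : ℝ) ^ (k + r)) ^ s ≤
      ((Fintype.card F : ℝ) ^ d) ^ k * ((Fintype.card F : ℝ) ^ (k + r)) ^ k := by
    have h := (Nat.cast_le (α := ℝ)).2 hbad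
    rw [Nat.cast_mul, Nat.cast_mul, Nat.cast_sub (Nat.one_le_pow _ _ Fintype.card_pos)] at h
    exact_mod_cast h
  have hΩ := pow_mul_le_ncard_OmegaSet_mul hm
  have hsub : badSet F (Fintype.card F) s k (U : Set E) ⊆ OmegaSet F E k := fun x hx => hx.1
  have hdiff : ((OmegaSet F E k \ badSet F (Fintype.card F) s k (U : Set E)).ncard : ℝ) =
      (OmegaSet F E k).ncard - (badSet F (Fintype.card F) s k (U : Set E)).ncard := by
    rw [Set.ncard_sdiff hsub (Set.toFinite _),
      Nat.cast_sub (Set.ncard_le_ncard hsub (Set.toFinite _))]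
  rw [hdiff, zpow_sub₀ (by positivity), zpow_natCast, zpow_natCast, pow_mul, pow_mul]
  have hpos : (0 : ℝ) < (Fintype.card F : ℝ) - 1 - ((Fintype.card F : ℝ) ^ r)⁻¹ := by
    have h2 : (2 : ℝ) ≤ Fintype.card F := by exact_mod_cast Fintype.one_lt_card (α := F)
    have hr : ((Fintype.card F : ℝ) ^ r)⁻¹ < 1 :=
      inv_lt_one_of_one_lt₀ (one_lt_pow₀ hq1 (by omega))
    linarith
  generalize ((badSet F (Fintype.card F) s k (U : Set E)).ncard : ℝ) = β at *
  generalize ((OmegaSet F E k).ncard : ℝ) = ω at *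
  generalize (Fintype.card F : ℝ) - 1 - ((Fintype.card F : ℝ) ^ r)⁻¹ = D at *
  have hMk : (0 : ℝ) < ((Fintype.card F : ℝ) ^ (k + r)) ^ k := by positivity
  have hMs : (0 : ℝ) < ((Fintype.card F : ℝ) ^ (k + r)) ^ s := by positivity
  have hP : (0 : ℝ) < ((Fintype.card F : ℝ) ^ d) ^ k := by positivity
  generalize ((Fintype.card F : ℝ) ^ (k + r)) ^ k = M at *
  generalize ((Fintype.card F : ℝ) ^ (k + r)) ^ s = S at *
  generalize ((Fintype.card F : ℝ) ^ d) ^ k = P at *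
  have hA : 0 < (Fintype.card F : ℝ) ^ a - 1 := sub_pos.2 hqa1
  have hQ : 0 < (Fintype.card F : ℝ) - 1 := sub_pos.2 hq1
  generalize (Fintype.card F : ℝ) ^ a - 1 = A at *
  generalize (Fintype.card F : ℝ) - 1 = Q at *
  have hω : 0 < ω := pos_of_mul_pos_left ((mul_pos hMk hpos).trans_le hΩ) hQ.le
  rw [sub_div, div_self hω.ne', ge_iff_le, sub_le_sub_iff_left, div_div, div_mul_div_comm,
    div_le_div_iff₀ hω (by positivity)]
  calc β * (S * A * D) = β * A * S * D := by ring
    _ ≤ P * M * D := mul_le_mul_of_nonneg_right hbad' hpos.le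
    _ = P * (M * D) := by ring
    _ ≤ P * (ω * Q) := mul_le_mul_of_nonneg_left hΩ hP.le
    _ = _ := by ring
end

section
/- Assume q ≥ 3, 1 ≤ s < d ≤ m, 1 ≤ r ≤ m, and ms ≥ d(m−r). Then for every F_q-linear subspace U ⊆ F_{q^m} of dimension d there exists an F_q-linear subspace V ⊆ F_{q^m} of dimension r such that the pair (U,V) is good. -/
open Finset

/-- The trace-dual of an `F`-subspace `V` of `E`, where `Tr(x) = ∑_{i<m} x^{q^i}`:
`V^⊥ = {x : ∀ v ∈ V, Tr(v*x) = 0}`. -/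
def traceDual {F E : Type*} [Field F] [Fintype F] [Field E] [Fintype E] [Algebra F E]
    (q m : ℕ) (hq : Fintype.card F = q) (V : Submodule F E) : Submodule F E where
  carrier := {x : E | ∀ v ∈ V, ∑ i ∈ Finset.range m, (v * x) ^ q ^ i = 0}
  zero_mem' := by
    intro v hv
    have hq0 : q ≠ 0 := by
      have h1 : 0 < Fintype.card F := Fintype.card_pos
      omega
    refine Finset.sum_eq_zero fun i _ => ?_
    rw [mul_zero, zero_pow (pow_ne_zero i hq0)]
  add_mem' := by
    intro x y hx hy v hv
    obtain ⟨n, hp, hcard⟩ := FiniteField.card F (ringChar F)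
    haveI : Fact (Nat.Prime (ringChar F)) := ⟨hp⟩
    haveI : CharP E (ringChar F) :=
      charP_of_injective_algebraMap (algebraMap F E).injective (ringChar F)
    have hq' : q = ringChar F ^ (n : ℕ) := by rw [← hq, hcard]
    have key : ∀ a b : E, ∀ i : ℕ, (a + b) ^ q ^ i = a ^ q ^ i + b ^ q ^ i := by
      intro a b i
      rw [hq', ← pow_mul]
      exact add_pow_char_pow a b (ringChar F) ((n : ℕ) * i)
    calc ∑ i ∈ Finset.range m, (v * (x + y)) ^ q ^ i
        = ∑ i ∈ Finset.range m, ((v * x) ^ q ^ i + (v * y) ^ q ^ i) := by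
          refine Finset.sum_congr rfl fun i _ => ?_
          rw [mul_add, key]
      _ = 0 := by rw [Finset.sum_add_distrib, hx v hv, hy v hv, add_zero]
  smul_mem' := by
    intro c x hx v hv
    have hc : ∀ i : ℕ, (algebraMap F E c) ^ q ^ i = algebraMap F E c := by
      intro i
      rw [← map_pow]
      congr 1
      calc c ^ q ^ i = c ^ Fintype.card F ^ i := by rw [hq]
        _ = c := FiniteField.pow_card_pow i c
    calc ∑ i ∈ Finset.range m, (v * (c • x)) ^ q ^ i
        = ∑ i ∈ Finset.range m, algebraMap F E c * (v * x) ^ q ^ i := by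
          refine Finset.sum_congr rfl fun i _ => ?_
          rw [Algebra.smul_def, mul_left_comm, mul_pow, hc]
      _ = algebraMap F E c * ∑ i ∈ Finset.range m, (v * x) ^ q ^ i := (Finset.mul_sum _ _ _).symm
      _ = 0 := by rw [hx v hv, mul_zero]

/-- A pair `(U, V)` of `F`-subspaces of `E` is *good* (for the parameter `s`) if
`m·s ≥ dim U · (m - dim V)` and for every `F`-basis `u₁, …, u_{dim U}` of `U` and all
`v'ᵢ ∈ V^⊥`: if `∑ᵢ v'ᵢ · uᵢ^{q^ℓ} = 0` for every `1 ≤ ℓ ≤ s`, then all `v'ᵢ = 0`. -/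
def IsGoodPair {F E : Type*} [Field F] [Fintype F] [Field E] [Fintype E] [Algebra F E]
    (q m s : ℕ) (hq : Fintype.card F = q) (U V : Submodule F E) : Prop :=
  m * s ≥ Module.finrank F U * (m - Module.finrank F V) ∧
  ∀ u : Fin (Module.finrank F U) → E,
    (∀ i, u i ∈ U) → LinearIndependent F u → Submodule.span F (Set.range u) = U →
  ∀ v' : Fin (Module.finrank F U) → E,
    (∀ i, v' i ∈ traceDual q m hq V) →
    (∀ ℓ : ℕ, 1 ≤ ℓ → ℓ ≤ s → ∑ i, v' i * u i ^ q ^ ℓ = 0) →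
    ∀ i, v' i = 0

theorem FiniteField.mem_range_algebraMap_of_pow_card_eq {F E : Type*} [Field F] [Fintype F]
    [Field E] [Finite E] [Algebra F E] {x : E} (hx : x ^ Fintype.card F = x) :
    x ∈ Set.range (algebraMap F E) := by
  have : Algebra.IsAlgebraic F E := Algebra.IsAlgebraic.of_finite F E
  have hfix : x ∈ (⊥ : IntermediateField F E) := by
    rw [IsGalois.mem_bot_iff_fixed]
    intro f
    obtain ⟨n, rfl⟩ := (FiniteField.bijective_frobeniusAlgEquivOfAlgebraic_pow F E).2 f
    simp only [FiniteField.coe_frobeniusAlgEquivOfAlgebraic_iterate, AlgEquiv.coe_pow]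
    generalize (n : ℕ) = k
    induction k with
    | zero => simp
    | succ k ih => rw [pow_succ, pow_mul, ih, hx]
  exact IntermediateField.mem_bot.1 hfix

/-- Nonsingularity of Moore matrices. -/
theorem eq_zero_of_sum_mul_frobenius_eq_zero {F E : Type*} [Field F] [Fintype F]
    [Field E] [Finite E] [Algebra F E] {n : ℕ} (a : ℕ) (b : Fin n → E)
    (hb : LinearIndependent F b) (c : Fin n → E)
    (h : ∀ l < n, ∑ k, c k * (FiniteField.frobeniusAlgHom F E ^ (a + l)) (b k) = 0) :
    c = 0 := by
  induction n generalizing a with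
  | zero => exact Subsingleton.elim _ _
  | succ n ih =>
    set φ := FiniteField.frobeniusAlgHom F E with hφ
    have hb' : LinearIndependent F (fun k : Fin n => b k.succ) :=
      hb.comp _ (Fin.succ_injective n)
    have hc0 : c 0 = 0 := by
      by_contra hne
      set e : Fin (n + 1) → E := fun k => c k / c 0 with he
      have he0 : e 0 = 1 := div_self hne
      have hsum : ∀ l < n + 1, ∑ k, e k * (φ ^ (a + l)) (b k) = 0 := fun l hl => by
        simp only [he, div_mul_eq_mul_div, ← Finset.sum_div, h l hl, zero_div]
      have hd : (fun k : Fin n => e k.succ - φ (e k.succ)) = 0 := by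
        refine ih (a + 1) _ hb' _ fun l hl => ?_
        have h1 := hsum (l + 1) (by omega)
        have h2 := congrArg φ (hsum l (by omega))
        rw [Fin.sum_univ_succ, he0] at h1 h2
        simp only [map_add, map_sum, map_mul, map_zero, map_one] at h2
        have h3 : ∀ y, φ ((φ ^ (a + l)) y) = (φ ^ (a + (l + 1))) y := fun y => by
          rw [← add_assoc, pow_succ', AlgHom.mul_apply]
        simp only [h3] at h2
        simp only [sub_mul, Finset.sum_sub_distrib, add_assoc, add_comm 1 l]
        linear_combination h1 - h2
      have hfix : ∀ k, ∃ f, algebraMap F E f = e k := by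
        refine Fin.cases ⟨1, by rw [he0, map_one]⟩ fun k => ?_
        exact FiniteField.mem_range_algebraMap_of_pow_card_eq (sub_eq_zero.1 (congrFun hd k)).symm
      choose f hf using hfix
      have h0 := hsum 0 (by omega)
      have h1 : (φ ^ (a + 0)) (∑ k, f k • b k) = 0 := by
        simp only [map_sum, map_smul]
        simpa only [Algebra.smul_def, hf] using h0
      have h2 := Fintype.linearIndependent_iff.1 hb f ((map_eq_zero _).1 h1) 0
      have h3 := hf 0
      rw [h2, he0, map_zero] at h3
      exact zero_ne_one h3
    have htail := ih a (fun k => b k.succ) hb' (fun k => c k.succ) fun l hl => by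
      simpa [Fin.sum_univ_succ, hc0] using h l (by omega)
    funext k
    exact Fin.cases hc0 (fun k => congrFun htail k) k

theorem pow_lt_two_mul_prod_pow_sub_pow {q m t : ℕ} (hq : 3 ≤ q) (ht : t < m) :
    q ^ (m * t) < 2 * ∏ i : Fin t, (q ^ m - q ^ (i : ℕ)) := by
  have key : ∀ k ≤ m, ((q : ℤ) ^ m) ^ k * (2 * q ^ m - q ^ k) ≤
      2 * q ^ m * ∏ i ∈ range k, ((q : ℤ) ^ m - q ^ i) := by
    intro k hk
    induction k with
    | zero => simp
    | succ k ih =>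
      have h := ih (by omega)
      have hle : (q : ℤ) ^ k ≤ q ^ m := pow_le_pow_right₀ (by omega) (by omega)
      have hq' : (3 : ℤ) ≤ q := by exact_mod_cast hq
      have hk0 : (0 : ℤ) < q ^ k := by positivity
      rw [Finset.prod_range_succ, pow_succ, pow_succ (q : ℤ) k]
      generalize (q : ℤ) ^ m = Q at *
      generalize (q : ℤ) ^ k = T at *
      have hQ : 0 ≤ Q ^ k := pow_nonneg (by linarith) k
      have h1 := mul_le_mul_of_nonneg_right h (sub_nonneg.2 hle)
      have h2 : Q * (2 * Q - T * q) ≤ (2 * Q - T) * (Q - T) := by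
        nlinarith [mul_nonneg (mul_nonneg (hk0.le.trans hle) hk0.le) (sub_nonneg.2 hq'),
          sq_nonneg T]
      have h3 := mul_le_mul_of_nonneg_left h2 hQ
      linarith
  have h := key t ht.le
  have hlt : (q : ℤ) ^ t < q ^ m := pow_lt_pow_right₀ (by omega) ht
  have hcast : ((∏ i : Fin t, (q ^ m - q ^ (i : ℕ)) : ℕ) : ℤ) =
      ∏ i ∈ range t, ((q : ℤ) ^ m - q ^ i) := by
    rw [← Fin.prod_univ_eq_prod_range (fun i => (q : ℤ) ^ m - q ^ i), Nat.cast_prod]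
    refine Finset.prod_congr rfl fun i _ => ?_
    rw [Nat.cast_sub (Nat.pow_le_pow_right (by omega) (by omega))]
    push_cast; rfl
  rw [← Nat.cast_lt (α := ℤ), Nat.cast_mul, hcast, pow_mul]
  push_cast
  have hm : (0 : ℤ) < q ^ m := by positivity
  generalize (∏ i ∈ range t, ((q : ℤ) ^ m - q ^ i)) = P at *
  generalize (q : ℤ) ^ m = Q at *
  generalize (q : ℤ) ^ t = T at *
  have hQ : 0 < Q ^ t := pow_pos hm t
  nlinarith [mul_pos hQ (sub_pos.2 hlt)]

theorem exists_fin_linearIndependent_comp {K V ι : Type*} [DivisionRing K] [AddCommGroup V]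
    [Module K V] [Finite ι] (x : ι → V) :
    ∃ (n : ℕ) (a : Fin n → ι), Function.Injective a ∧ LinearIndependent K (x ∘ a) ∧
      ∀ j, x j ∈ Submodule.span K (Set.range (x ∘ a)) := by
  obtain ⟨κ, a, ha, hspan, hli⟩ := exists_linearIndependent' K x
  have : Finite κ := Finite.of_injective a ha
  obtain ⟨n, ⟨e⟩⟩ := Finite.exists_equiv_fin κ
  refine ⟨n, a ∘ e.symm, ha.comp e.symm.injective, hli.comp _ e.symm.injective, fun j => ?_⟩
  rw [← Function.comp_assoc, e.symm.surjective.range_comp, hspan]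
  exact Submodule.subset_span ⟨j, rfl⟩

section Moore

variable {F E : Type*} [Field F] [Fintype F] [Field E] [Algebra F E]

/-- A tuple `x` of rank at most `s` cannot be killed by an independent tuple `w`. -/
theorem eq_zero_of_linearIndependent_of_sum_mul_frobenius_eq_zero [Finite E] {ι : Type*}
    [Fintype ι] {s n : ℕ} (c : ℕ) {w x : ι → E} (hw : LinearIndependent F w)
    {a : Fin n → ι} (hli : LinearIndependent F (x ∘ a))
    (hspan : ∀ j, x j ∈ Submodule.span F (Set.range (x ∘ a))) (hn : n ≤ s)
    (h : ∀ l < s, ∑ j, w j * (FiniteField.frobeniusAlgHom F E ^ (c + l)) (x j) = 0) :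
    x = 0 := by
  simp only [Submodule.mem_span_range_iff_exists_fun] at hspan
  choose A hA using hspan
  have hz := eq_zero_of_sum_mul_frobenius_eq_zero c _ hli (fun k => ∑ j, A j k • w j)
    fun l hl => by
      rw [← h l (hl.trans_le hn)]
      simp only [← hA, map_sum, map_smul, Finset.mul_sum, Finset.sum_mul]
      rw [Finset.sum_comm]
      refine Finset.sum_congr rfl fun j _ => Finset.sum_congr rfl fun k _ => ?_
      rw [smul_mul_assoc, mul_smul_comm]
  have hA0 : ∀ j k, A j k = 0 := fun j k =>
    Fintype.linearIndependent_iff.1 hw (fun j => A j k) (congrFun hz k) j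
  funext j
  simp [← hA j, hA0]

theorem card_sum_mul_frobenius_eq_zero_mul_le [Fintype E] {ι : Type*} [Fintype ι]
    [DecidableEq ι] {s : ℕ} (c : ℕ) {x : ι → E} {a : Fin s → ι} (ha : Function.Injective a)
    (hli : LinearIndependent F (x ∘ a)) (S : Finset (ι → E))
    (hS : ∀ w ∈ S, ∀ l < s,
      ∑ j, w j * (FiniteField.frobeniusAlgHom F E ^ (c + l)) (x j) = 0) :
    S.card * Fintype.card E ^ s ≤ Fintype.card E ^ Fintype.card ι := by
  have hext : ∀ y : Fin s → E, ∀ f : ι → E,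
      ∑ j, Function.extend a y 0 j * f j = ∑ k, y k * f (a k) := fun y f => by
    rw [← Finset.sum_subset (Finset.subset_univ (univ.map ⟨a, ha⟩)), Finset.sum_map]
    · simp [ha.extend_apply]
    · intro j _ hj
      rw [Function.extend_apply' _ _ _ (by simpa using hj)]
      simp
  let g : S × (Fin s → E) → ι → E := fun p => p.1.1 + Function.extend a p.2 0
  have hg : Function.Injective g := by
    rintro ⟨⟨w, hw⟩, y⟩ ⟨⟨w', hw'⟩, y'⟩ hgg
    have hgg : w + Function.extend a y 0 = w' + Function.extend a y' 0 := hgg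
    have hy : y - y' = 0 := by
      refine eq_zero_of_sum_mul_frobenius_eq_zero c _ hli _ fun l hl => ?_
      have h1 := hext y fun j => (FiniteField.frobeniusAlgHom F E ^ (c + l)) (x j)
      have h2 := hext y' fun j => (FiniteField.frobeniusAlgHom F E ^ (c + l)) (x j)
      have h3 := congrArg
        (fun v => ∑ j, v j * (FiniteField.frobeniusAlgHom F E ^ (c + l)) (x j)) hgg
      simp only [Pi.add_apply, add_mul, Finset.sum_add_distrib, hS w hw l hl,
        hS w' hw' l hl, zero_add] at h3
      simp only [Pi.sub_apply, sub_mul, Finset.sum_sub_distrib, Function.comp_apply]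
      rw [← h1, ← h2, h3, sub_self]
    obtain rfl := sub_eq_zero.1 hy
    obtain rfl := add_right_cancel hgg
    rfl
  simpa using Fintype.card_le_of_injective g hg

theorem card_linearIndependent_sum_mul_frobenius_eq_zero_mul_le [Fintype E] {ι : Type*}
    [Fintype ι] {s : ℕ} (c : ℕ) {x : ι → E} (hx : x ≠ 0) (S : Finset (ι → E))
    (hli : ∀ w ∈ S, LinearIndependent F w)
    (hS : ∀ w ∈ S, ∀ l < s,
      ∑ j, w j * (FiniteField.frobeniusAlgHom F E ^ (c + l)) (x j) = 0) :
    S.card * Fintype.card E ^ s ≤ Fintype.card E ^ Fintype.card ι := by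
  classical
  obtain ⟨n, a, ha, hxa, hspan⟩ := exists_fin_linearIndependent_comp (K := F) x
  rcases le_total n s with hn | hn
  · obtain rfl : S = ∅ := Finset.eq_empty_of_forall_notMem fun w hw =>
      hx (eq_zero_of_linearIndependent_of_sum_mul_frobenius_eq_zero c (hli w hw) hxa hspan hn
        (hS w hw))
    simp
  · exact card_sum_mul_frobenius_eq_zero_mul_le c (ha.comp (Fin.castLE_injective hn))
      (hxa.comp _ (Fin.castLE_injective hn)) S hS

/-- The counting argument: if `|U|^t ≤ |E|^s`, some independent `t`-tuple `w` makes
`x ↦ (∑ⱼ wⱼ xⱼ^{q^{c+l}})_{l < s}` injective on `Uᵗ`. -/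
theorem exists_linearIndependent_forall_sum_mul_frobenius_eq_zero [Fintype E] {t s : ℕ} (c : ℕ)
    (hq : 3 ≤ Fintype.card F) (ht : t < Module.finrank F E) (U : Submodule F E)
    (hU : Module.finrank F U * t ≤ Module.finrank F E * s) :
    ∃ w : Fin t → E, LinearIndependent F w ∧ ∀ x : Fin t → E, (∀ j, x j ∈ U) →
      (∀ l < s, ∑ j, w j * (FiniteField.frobeniusAlgHom F E ^ (c + l)) (x j) = 0) → x = 0 := by
  classical
  by_contra! hcon
  let S : Finset (Fin t → E) := univ.filter fun w => LinearIndependent F w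
  let T : Finset (Fin t → U) := univ.filter fun x => x ≠ 0
  let R : (Fin t → E) → (Fin t → U) → Prop := fun w x =>
    ∀ l < s, ∑ j, w j * (FiniteField.frobeniusAlgHom F E ^ (c + l)) (x j : E) = 0
  have hScard : S.card = ∏ i : Fin t,
      (Fintype.card F ^ Module.finrank F E - Fintype.card F ^ (i : ℕ)) := by
    rw [← card_linearIndependent ht.le, Nat.card_eq_fintype_card, Fintype.card_subtype]
  have habove : ∀ w ∈ S, 2 ≤ (T.bipartiteAbove R w).card := by
    intro w hw
    obtain ⟨x, hxU, hx, hx0⟩ := hcon w (by simpa [S] using hw)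
    let x' : Fin t → U := fun j => ⟨x j, hxU j⟩
    have hx' : x' ≠ 0 := fun h => hx0 (funext fun j => congrArg Subtype.val (congrFun h j))
    let g : {f : F // f ≠ 0} → Fin t → U := fun f => f.1 • x'
    have hg : Function.Injective g := fun f f' h => Subtype.ext (smul_left_injective F hx' h)
    have hsub : univ.image g ⊆ T.bipartiteAbove R w := by
      intro y hy
      obtain ⟨f, -, rfl⟩ := Finset.mem_image.1 hy
      rw [Finset.mem_bipartiteAbove]
      refine ⟨by simpa [T, g, f.2] using hx', fun l hl => ?_⟩
      have := hx l hl
      simp only [g, x', Pi.smul_apply, Submodule.coe_smul, map_smul, mul_smul_comm,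
        ← Finset.smul_sum, this, smul_zero]
    have hcard := Finset.card_le_card hsub
    rw [Finset.card_image_of_injective _ hg, Finset.card_univ, Fintype.card_subtype_compl,
      Fintype.card_subtype_eq] at hcard
    omega
  have hbelow : ∀ x ∈ T, (S.bipartiteBelow R x).card * Fintype.card E ^ s ≤
      Fintype.card E ^ t := by
    intro x hx
    have hx0 : (fun j => (x j : E)) ≠ 0 := fun h => (Finset.mem_filter.1 hx).2
      (funext fun j => Subtype.ext (congrFun h j))
    have := card_linearIndependent_sum_mul_frobenius_eq_zero_mul_le (F := F) c hx0
      (S.bipartiteBelow R x)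
      (fun w hw => (Finset.mem_filter.1 ((Finset.mem_bipartiteBelow R).1 hw).1).2)
      (fun w hw => ((Finset.mem_bipartiteBelow R).1 hw).2)
    simpa using this
  have hT : T.card ≤ Fintype.card E ^ s := by
    refine (Finset.card_le_univ T).trans ?_
    rw [Fintype.card_fun, Fintype.card_fin, Module.card_eq_pow_finrank (K := F) (V := U),
      Module.card_eq_pow_finrank (K := F) (V := E), ← pow_mul, ← pow_mul]
    exact Nat.pow_le_pow_right (by omega) hU
  have hpos : 0 < Fintype.card E ^ s := pow_pos Fintype.card_pos s
  have hle : 2 * S.card ≤ Fintype.card E ^ t := by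
    refine le_of_mul_le_mul_right ?_ hpos
    calc 2 * S.card * Fintype.card E ^ s
        ≤ (∑ w ∈ S, (T.bipartiteAbove R w).card) * Fintype.card E ^ s := by
          refine Nat.mul_le_mul_right _ ?_
          rw [mul_comm, ← smul_eq_mul]
          exact Finset.card_nsmul_le_sum _ _ _ habove
      _ = ∑ x ∈ T, (S.bipartiteBelow R x).card * Fintype.card E ^ s := by
          rw [Finset.sum_card_bipartiteAbove_eq_sum_card_bipartiteBelow, Finset.sum_mul]
      _ ≤ T.card * Fintype.card E ^ t := by
          rw [← smul_eq_mul]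
          exact Finset.sum_le_card_nsmul _ _ _ hbelow
      _ ≤ Fintype.card E ^ t * Fintype.card E ^ s := by
          rw [mul_comm]
          exact Nat.mul_le_mul_left _ hT
  have hlt := pow_lt_two_mul_prod_pow_sub_pow hq ht
  rw [← hScard, pow_mul, ← Module.card_eq_pow_finrank (K := F) (V := E)] at hlt
  omega

end Moore

theorem traceDual_eq_orthogonal {F E : Type*} [Field F] [Fintype F] [Field E] [Fintype E]
    [Algebra F E] {q m : ℕ} (hq : Fintype.card F = q) (hm : Module.finrank F E = m)
    (V : Submodule F E) :
    traceDual q m hq V = (Algebra.traceForm F E).orthogonal V := by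
  ext x
  have key : ∀ y : E, ∑ i ∈ Finset.range m, y ^ q ^ i = 0 ↔ Algebra.trace F E y = 0 := by
    intro y
    rw [← map_eq_zero (algebraMap F E), FiniteField.algebraMap_trace_eq_sum_pow, hm,
      Nat.card_eq_fintype_card, hq]
  simp only [LinearMap.BilinForm.mem_orthogonal_iff, Algebra.traceForm_apply, ← key]
  rfl

/-- If `q ≥ 3`, `1 ≤ s < d ≤ m`, `1 ≤ r ≤ m`, and `ms ≥ d(m-r)`, then for every
`F_q`-subspace `U ⊆ F_{q^m}` of dimension `d` there exists an `F_q`-subspace `V ⊆ F_{q^m}` of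
dimension `r` such that `(U, V)` is a good pair. -/
theorem stmt_9 {F E : Type*} [Field F] [Fintype F] [Field E] [Fintype E] [Algebra F E]
    (q m s d r : ℕ) (hq : Fintype.card F = q) (hm : Module.finrank F E = m)
    (hq3 : 3 ≤ q) (hs1 : 1 ≤ s) (hsd : s < d) (hdm : d ≤ m) (hr1 : 1 ≤ r) (hrm : r ≤ m)
    (hms : d * (m - r) ≤ m * s)
    (U : Submodule F E) (hU : Module.finrank F U = d) :
    ∃ V : Submodule F E, Module.finrank F V = r ∧ IsGoodPair q m s hq U V := by
  have hsep : (Algebra.traceForm F E).Nondegenerate := traceForm_nondegenerate F E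
  have hrefl : (Algebra.traceForm F E).IsRefl := (Algebra.traceForm_isSymm F).isRefl
  obtain ⟨w, hw, hinj⟩ := exists_linearIndependent_forall_sum_mul_frobenius_eq_zero
    (t := m - r) (s := s) 1 (by omega) (by omega) U (by rw [hU, hm]; exact hms)
  refine ⟨(Algebra.traceForm F E).orthogonal (Submodule.span F (Set.range w)), ?_, ?_⟩
  · rw [LinearMap.BilinForm.finrank_orthogonal hsep, finrank_span_eq_card hw, hm,
      Fintype.card_fin]
    omega
  refine ⟨?_, fun u hu hli _ v' hv' h => ?_⟩
  · rw [LinearMap.BilinForm.finrank_orthogonal hsep, finrank_span_eq_card hw, hm, hU,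
      Fintype.card_fin, show m - (m - (m - r)) = m - r by omega]
    exact hms
  simp only [traceDual_eq_orthogonal hq hm,
    LinearMap.BilinForm.orthogonal_orthogonal hsep hrefl,
    Submodule.mem_span_range_iff_exists_fun] at hv'
  choose A hA using hv'
  have hx := hinj (fun j => ∑ i, A i j • u i)
    (fun j => U.sum_mem fun i _ => U.smul_mem _ (hu i)) fun l hl => by
      rw [← h (1 + l) (by omega) (by omega)]
      have hpow : ∀ y : E, y ^ q ^ (1 + l) = (FiniteField.frobeniusAlgHom F E ^ (1 + l)) y :=
        fun y => by
          rw [AlgHom.coe_pow, FiniteField.coe_frobeniusAlgHom, pow_iterate, hq]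
      simp only [hpow, ← hA, map_sum, map_smul, Finset.mul_sum, Finset.sum_mul]
      rw [Finset.sum_comm]
      refine Finset.sum_congr rfl fun i _ => Finset.sum_congr rfl fun j _ => ?_
      rw [smul_mul_assoc, mul_smul_comm]
  have hA0 : ∀ i j, A i j = 0 := fun i j =>
    Fintype.linearIndependent_iff.1 hli (fun i => A i j) (congrFun hx j) i
  intro i
  simp [← hA i, hA0]
end
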